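/- The average delay is bounded below in terms of the expected maximum load: for every association g, T̄(g) ≥ ((Λ−t)/(1+t)) · ( E[l_1] · t/(Λ−1) + (K_p/Λ) · (Λ−t−1)/(Λ−1) ). -/

import Mathlib

open Finset

noncomputable section

/-- Probability weight of an activity pattern `ω` under independent Bernoulli
activities with success probabilities `p`. -/
def wgt {K : ℕ} (p : Fin K → ℝ) (ω : Fin K → Bool) : ℝ :=
  ∏ k, if ω k then p k else 1 - p k

/-- Load of cache `c` under association `g` and activity pattern `ω`:
the number of active users assigned to cache `c`. -/
def load {K Λ : ℕ} (g : Fin K → Fin Λ) (ω : Fin K → Bool) (c : Fin Λ) : ℕ :=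
  ∑ k, if g k = c ∧ ω k = true then 1 else 0

/-- Decreasing rearrangement of a tuple of naturals, indexed by `ℕ`
(value `0` out of range): `sortDescN v 0` is the largest entry,
`sortDescN v (Λ-1)` the smallest. -/
def sortDescN {Λ : ℕ} (v : Fin Λ → ℕ) (i : ℕ) : ℕ :=
  if h : i < Λ then (v ∘ Tuple.sort v) (Fin.rev ⟨i, h⟩) else 0

/-- Expectation of a real-valued functional of the activity pattern. -/
def expec {K : ℕ} (p : Fin K → ℝ) (f : (Fin K → Bool) → ℝ) : ℝ :=
  ∑ ω : Fin K → Bool, wgt p ω * f ω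

/-- Average worst-case delay of association `g`:
`T̄(g) = ∑_{λ=1}^{Λ-t} E[l_λ] C(Λ-λ,t)/C(Λ,t)` (here `i = λ - 1` is 0-based). -/
def avgDelay {K Λ : ℕ} (p : Fin K → ℝ) (g : Fin K → Fin Λ) (t : ℕ) : ℝ :=
  ∑ i ∈ Finset.range (Λ - t),
    expec p (fun ω => (sortDescN (load g ω) i : ℝ)) * ((Λ - 1 - i).choose t : ℝ) /
      (Λ.choose t : ℝ)

/-- `μ_λ`: expected number of active users assigned to cache `c`. -/
def muC {K Λ : ℕ} (p : Fin K → ℝ) (g : Fin K → Fin Λ) (c : Fin Λ) : ℝ :=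
  ∑ k, if g k = c then p k else 0

/-- `σ_λ²`: variance of the number of active users assigned to cache `c`. -/
def sigma2C {K Λ : ℕ} (p : Fin K → ℝ) (g : Fin K → Fin Λ) (c : Fin Λ) : ℝ :=
  ∑ k, if g k = c then p k * (1 - p k) else 0

/-- `|G_λ|`: the number of users assigned to cache `c`. -/
def Gcard {K Λ : ℕ} (g : Fin K → Fin Λ) (c : Fin Λ) : ℕ :=
  (Finset.univ.filter fun k => g k = c).card

/-- Binomial cumulative distribution function `F_bin(n,q,x)`. -/
def Fbin (n : ℕ) (q : ℝ) (x : ℕ) : ℝ :=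
  ∑ i ∈ Finset.range (x + 1), (n.choose i : ℝ) * q ^ i * (1 - q) ^ (n - i)

theorem sortDescN_antitone {Λ : ℕ} (v : Fin Λ → ℕ) : Antitone (sortDescN v) := by
  intro i j hij
  unfold sortDescN
  by_cases hj : j < Λ
  · have hi : i < Λ := hij.trans_lt hj
    rw [dif_pos hj, dif_pos hi]
    apply Tuple.monotone_sort v
    rw [Fin.rev_le_rev]
    exact hij
  · rw [dif_neg hj]
    exact Nat.zero_le _

theorem sum_sortDescN {Λ : ℕ} (v : Fin Λ → ℕ) :
    ∑ i ∈ Finset.range Λ, sortDescN v i = ∑ c, v c := by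
  rw [← Fin.sum_univ_eq_sum_range, ← Equiv.sum_comp (Fin.revPerm.trans (Tuple.sort v)) v]
  refine Finset.sum_congr rfl fun i _ => ?_
  simp [sortDescN]

theorem sum_load {K Λ : ℕ} (g : Fin K → Fin Λ) (ω : Fin K → Bool) :
    ∑ c, load g ω c = ∑ k, if ω k = true then 1 else 0 := by
  unfold load
  rw [Finset.sum_comm]
  refine Finset.sum_congr rfl fun k _ => ?_
  by_cases h : ω k = true <;> simp [h]

theorem wgt_nonneg {K : ℕ} {p : Fin K → ℝ} (hp : ∀ k, 0 ≤ p k ∧ p k ≤ 1)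
    (ω : Fin K → Bool) : 0 ≤ wgt p ω := by
  refine Finset.prod_nonneg fun k _ => ?_
  split_ifs
  · exact (hp k).1
  · linarith [(hp k).2]

theorem expec_mono {K : ℕ} {p : Fin K → ℝ} (hp : ∀ k, 0 ≤ p k ∧ p k ≤ 1)
    {f h : (Fin K → Bool) → ℝ} (hfh : ∀ ω, f ω ≤ h ω) : expec p f ≤ expec p h :=
  Finset.sum_le_sum fun ω _ => mul_le_mul_of_nonneg_left (hfh ω) (wgt_nonneg hp ω)

theorem expec_sum {K : ℕ} {ι : Type*} (p : Fin K → ℝ) (s : Finset ι)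
    (f : ι → (Fin K → Bool) → ℝ) :
    expec p (fun ω => ∑ i ∈ s, f i ω) = ∑ i ∈ s, expec p (fun ω => f i ω) := by
  simp only [expec, Finset.mul_sum]
  exact Finset.sum_comm

theorem expec_add {K : ℕ} (p : Fin K → ℝ) (f h : (Fin K → Bool) → ℝ) :
    expec p (fun ω => f ω + h ω) = expec p f + expec p h := by
  simp only [expec, mul_add, Finset.sum_add_distrib]

theorem expec_mul_const {K : ℕ} (p : Fin K → ℝ) (f : (Fin K → Bool) → ℝ) (a : ℝ) :
    expec p (fun ω => f ω * a) = expec p f * a := by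
  simp only [expec, Finset.sum_mul, mul_assoc]

theorem expec_indicator {K : ℕ} (p : Fin K → ℝ) (k : Fin K) :
    expec p (fun ω => if ω k = true then 1 else 0) = p k := by
  have h := Finset.prod_univ_sum (fun _ : Fin K => (Finset.univ : Finset Bool))
    (fun i b => (if b then p i else 1 - p i) *
      (if i = k then (if b = true then (1 : ℝ) else 0) else 1))
  simp only [Fintype.piFinset_univ, Finset.prod_mul_distrib, Finset.prod_ite_eq',
    Finset.mem_univ, if_true] at h
  unfold expec wgt
  rw [← h, Finset.prod_eq_single k]
  · simp
  · intro i _ hi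
    simp [hi]
  · simp

theorem expec_sum_load {K Λ : ℕ} (p : Fin K → ℝ) (g : Fin K → Fin Λ) :
    expec p (fun ω => ((∑ c, load g ω c : ℕ) : ℝ)) = ∑ k, p k := by
  simp only [sum_load, Nat.cast_sum, Nat.cast_ite, Nat.cast_one, Nat.cast_zero]
  rw [expec_sum]
  exact Finset.sum_congr rfl fun k _ => expec_indicator p k

theorem sum_range_sub_choose (n t : ℕ) :
    ∑ i ∈ Finset.range (n + 1), (n - i).choose t = (n + 1).choose (t + 1) := by
  induction n with
  | zero => cases t <;> simp [Nat.choose_succ_succ]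
  | succ n ih =>
    rw [Finset.sum_range_succ']
    simp only [Nat.add_sub_add_right, ih, Nat.sub_zero]
    rw [Nat.choose_succ_succ (n + 1) t, add_comm]

/-- Chebyshev's sum inequality applied to all terms but the first. -/
theorem antitone_sum_mul_ge {a c : ℕ → ℝ} (ha : Antitone a) (hc : Antitone c) (n : ℕ) :
    n * (a 0 * c 0) + (∑ i ∈ Finset.range (n + 1), a i - a 0) *
        (∑ i ∈ Finset.range (n + 1), c i - c 0) ≤
      n * ∑ i ∈ Finset.range (n + 1), a i * c i := by
  have h : Monovary (fun i => a (i + 1)) (fun i => c (i + 1)) :=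
    Antitone.monovary (fun i j hij => ha (by omega)) (fun i j hij => hc (by omega))
  have h' := (h.monovaryOn (s := (Finset.range n : Set ℕ))).sum_mul_sum_le_card_mul_sum
  rw [Finset.card_range] at h'
  simp only [Finset.sum_range_succ' _ n, add_sub_cancel_right]
  linarith

/-- The lower bound for a fixed decreasing profile of loads. -/
theorem antitone_sum_choose_ge {a : ℕ → ℝ} (ha : Antitone a) {n t : ℕ} (hn : 1 ≤ n)
    (ht : t ≤ n) :
    a 0 * (((n : ℝ) + 1 - t) / (1 + t) * (t / n)) +
        (∑ i ∈ Finset.range (n + 1), a i) *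
          (((n : ℝ) + 1 - t) / (1 + t) * ((n - t) / ((n + 1) * n))) ≤
      ∑ i ∈ Finset.range (n + 1), a i * (((n - i).choose t : ℝ) / ((n + 1).choose t : ℝ)) := by
  have hC : (0 : ℝ) < ((n + 1).choose t : ℝ) := by
    exact_mod_cast Nat.choose_pos (by omega)
  have hn0 : (0 : ℝ) < n := by exact_mod_cast hn
  have hc : Antitone fun i : ℕ => ((n - i).choose t : ℝ) / ((n + 1).choose t : ℝ) := by
    intro i j hij
    dsimp only
    gcongr
  have hsum : ∑ i ∈ Finset.range (n + 1), ((n - i).choose t : ℝ) / ((n + 1).choose t : ℝ) =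
      ((n : ℝ) + 1 - t) / (1 + t) := by
    rw [← Finset.sum_div, ← Nat.cast_sum, sum_range_sub_choose,
      div_eq_div_iff hC.ne' (by positivity)]
    have h := Nat.choose_succ_right_eq (n + 1) t
    have h' : (((n + 1).choose (t + 1) * (t + 1) : ℕ) : ℝ) =
        ((n + 1).choose t * (n + 1 - t) : ℕ) := by rw [h]
    rw [Nat.cast_mul, Nat.cast_mul, Nat.cast_sub (by omega)] at h'
    push_cast at h'
    linarith
  have hzero : ((n - 0).choose t : ℝ) / ((n + 1).choose t : ℝ) = ((n : ℝ) + 1 - t) / (n + 1) := by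
    rw [div_eq_div_iff hC.ne' (by positivity), Nat.sub_zero]
    have h := Nat.choose_mul_succ_eq n t
    have h' : ((n.choose t * (n + 1) : ℕ) : ℝ) =
        ((n + 1).choose t * (n + 1 - t) : ℕ) := by rw [h]
    rw [Nat.cast_mul, Nat.cast_mul, Nat.cast_sub (by omega)] at h'
    push_cast at h'
    linarith
  have h := antitone_sum_mul_ge ha hc n
  rw [hsum, hzero] at h
  refine le_of_mul_le_mul_left (le_trans (le_of_eq ?_) h) hn0
  field_simp
  ring

theorem avgDelay_eq_expec {K n t : ℕ} (p : Fin K → ℝ) (g : Fin K → Fin (n + 1)) :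
    avgDelay p g t = expec p (fun ω => ∑ i ∈ Finset.range (n + 1),
      (sortDescN (load g ω) i : ℝ) * (((n - i).choose t : ℝ) / ((n + 1).choose t : ℝ))) := by
  unfold avgDelay
  rw [expec_sum]
  simp only [expec_mul_const, mul_div_assoc, Nat.add_sub_cancel]
  refine Finset.sum_subset (Finset.range_mono (Nat.sub_le (n + 1) t)) fun i hi hi' => ?_
  rw [Finset.mem_range] at hi hi'
  rw [Nat.choose_eq_zero_of_lt (by omega : n - i < t)]
  simp

/-- The average delay is bounded below in terms of the expected maximum load. -/
theorem avgDelay_ge_expMaxLoad_bound {K Λ t : ℕ} (hΛ : 2 ≤ Λ) (ht1 : 1 ≤ t) (ht2 : t ≤ Λ - 1)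
    (p : Fin K → ℝ) (hp : ∀ k, 0 ≤ p k ∧ p k ≤ 1) (g : Fin K → Fin Λ) :
    ((Λ : ℝ) - t) / (1 + t) *
        (expec p (fun ω => (sortDescN (load g ω) 0 : ℝ)) * (t : ℝ) / ((Λ : ℝ) - 1) +
          ((∑ k, p k) / (Λ : ℝ)) * ((Λ : ℝ) - t - 1) / ((Λ : ℝ) - 1)) ≤
      avgDelay p g t := by
  obtain ⟨n, rfl⟩ : ∃ n, Λ = n + 1 := ⟨Λ - 1, by omega⟩
  have hn : 1 ≤ n := by omega
  have hn0 : (0 : ℝ) < n := by exact_mod_cast hn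
  have h := expec_mono hp fun ω => antitone_sum_choose_ge
    (a := fun i => (sortDescN (load g ω) i : ℝ))
    (fun i j hij => Nat.cast_le.mpr (sortDescN_antitone (load g ω) hij)) hn
    (by omega : t ≤ n)
  rw [← avgDelay_eq_expec, expec_add, expec_mul_const, expec_mul_const] at h
  simp only [← Nat.cast_sum, sum_sortDescN] at h
  rw [expec_sum_load] at h
  refine le_trans (le_of_eq ?_) h
  push_cast
  rw [add_sub_cancel_right]
  field_simp
  ring

end
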